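/- arXiv:2106.13350 — 2 statements merged into one kernel-verified Lean document; each statement's English description precedes it below -/
import Mathlib

section
/- If the reference-dependent random choice rule {p_r}_{r∈X} satisfies NCC and SQA, then the binary relation ⪰ on X defined by x ⪰ y if and only if x = y or p_y(x,{x,y}) > 0 is complete (for all x,y, x ⪰ y or y ⪰ x), antisymmetric (x ⪰ y and y ⪰ x imply x = y), and transitive — that is, ⪰ is a linear order on X. -/
open Finset
open scoped Classical

namespace RDRAM

noncomputable section

variable {α : Type*} [Fintype α] [DecidableEq α]

/-- `x` is the `R`-maximum of `D`. -/
def IsMaxOf (R : α → α → Prop) (x : α) (D : Finset α) : Prop :=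
  x ∈ D ∧ ∀ y ∈ D, R x y

/-- `R` is a linear order: complete, antisymmetric, transitive. -/
structure LinOrd (R : α → α → Prop) : Prop where
  total : ∀ x y, R x y ∨ R y x
  antisymm : ∀ x y, R x y → R y x → x = y
  trans : ∀ x y z, R x y → R y z → R x z

/-- A reference-dependent random choice rule `p r x S`. -/
structure IsRandomChoiceRule (p : α → α → Finset α → ℝ) : Prop where
  nonneg : ∀ r x S, 0 ≤ p r x S
  support : ∀ r x (S : Finset α), S.Nonempty → r ∈ S → 0 < p r x S → x ∈ S
  sum_one : ∀ r (S : Finset α), S.Nonempty → r ∈ S → ∑ x ∈ S, p r x S = 1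

/-- A stochastic choice rule `q x S` (no reference). -/
structure IsStochasticChoiceRule (q : α → Finset α → ℝ) : Prop where
  nonneg : ∀ x S, 0 ≤ q x S
  support : ∀ x (S : Finset α), S.Nonempty → 0 < q x S → x ∈ S
  sum_one : ∀ S : Finset α, S.Nonempty → ∑ x ∈ S, q x S = 1

/-- A random attention rule `μ D S` for reference `r`. -/
structure IsAttentionRule (r : α) (μ : Finset α → Finset α → ℝ) : Prop where
  nonneg : ∀ D S, 0 ≤ μ D S
  support : ∀ (S D : Finset α), S.Nonempty → r ∈ S → 0 < μ D S → r ∈ D ∧ D ⊆ S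
  sum_one : ∀ (S : Finset α), S.Nonempty → r ∈ S → ∑ D ∈ S.powerset, μ D S = 1

/-- Full support: every admissible consideration set has positive probability. -/
def FullSupport (r : α) (μ : Finset α → Finset α → ℝ) : Prop :=
  ∀ (S D : Finset α), S.Nonempty → r ∈ S → r ∈ D → D ⊆ S → 0 < μ D S

/-- `(R, μ)` is an RD-RAM representation of `p`. -/
def IsRDRAMRep (p : α → α → Finset α → ℝ) (R : α → α → Prop)
    (μ : α → Finset α → Finset α → ℝ) : Prop :=
  LinOrd R ∧ (∀ r, IsAttentionRule r (μ r) ∧ FullSupport r (μ r)) ∧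
    ∀ r (S : Finset α), S.Nonempty → r ∈ S → ∀ x ∈ S,
      p r x S = ∑ D ∈ S.powerset.filter (fun D => r ∈ D ∧ IsMaxOf R x D), μ r D S

/-- Independent Random Attention representation of an attention rule. -/
def HasIRA (r : α) (μ : Finset α → Finset α → ℝ) : Prop :=
  ∃ γ : α → ℝ, γ r = 1 ∧ (∀ x, x ≠ r → 0 < γ x ∧ γ x < 1) ∧
    ∀ (S : Finset α), S.Nonempty → r ∈ S → ∀ D : Finset α, r ∈ D → D ⊆ S →
      μ D S = (∏ x ∈ D, γ x) * ∏ y ∈ S \ D, (1 - γ y)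

/-- Luce Random Attention representation of an attention rule. -/
def HasLRA (r : α) (μ : Finset α → Finset α → ℝ) : Prop :=
  ∃ π : Finset α → ℝ, (∀ D : Finset α, r ∈ D → 0 < π D) ∧
    (∑ D ∈ (univ : Finset α).powerset.filter (fun D => r ∈ D), π D = 1) ∧
    ∀ (S : Finset α), S.Nonempty → r ∈ S → ∀ D : Finset α, r ∈ D → D ⊆ S →
      μ D S = π D / ∑ D' ∈ S.powerset.filter (fun D' => r ∈ D'), π D'

/-- Constant Random Attention representation of an attention rule. -/
def HasCRA (r : α) (μ : Finset α → Finset α → ℝ) : Prop :=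
  ∃ π : Finset α → ℝ, (∀ D : Finset α, r ∈ D → 0 < π D) ∧
    (∑ D ∈ (univ : Finset α).powerset.filter (fun D => r ∈ D), π D = 1) ∧
    ∀ (S : Finset α), S.Nonempty → r ∈ S → ∀ D : Finset α, r ∈ D → D ⊆ S →
      μ D S = ∑ D' ∈ (univ : Finset α).powerset.filter (fun D' => D' ∩ S = D), π D'

/-- `p` has an IRA representation. -/
def HasIRARep (p : α → α → Finset α → ℝ) : Prop :=
  ∃ (R : α → α → Prop) (μ : α → Finset α → Finset α → ℝ),
    IsRDRAMRep p R μ ∧ ∀ r, HasIRA r (μ r)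

/-- `p` has an LRA representation. -/
def HasLRARep (p : α → α → Finset α → ℝ) : Prop :=
  ∃ (R : α → α → Prop) (μ : α → Finset α → Finset α → ℝ),
    IsRDRAMRep p R μ ∧ ∀ r, HasLRA r (μ r)

/-- `p` has a CRA representation. -/
def HasCRARep (p : α → α → Finset α → ℝ) : Prop :=
  ∃ (R : α → α → Prop) (μ : α → Finset α → Finset α → ℝ),
    IsRDRAMRep p R μ ∧ ∀ r, HasCRA r (μ r)

/-- No-Cycle Condition. -/
def NCC (p : α → α → Finset α → ℝ) : Prop :=
  ∀ (n : ℕ) (x : Fin (n + 1) → α) (Sq : Fin (n + 1) → Finset α),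
    (∀ i, (Sq i).Nonempty ∧ x i ∈ Sq i) →
    (∀ i : Fin n, x i.succ ∈ Sq i.castSucc ∧ x i.succ ≠ x i.castSucc ∧
      0 < p (x i.castSucc) (x i.succ) (Sq i.castSucc)) →
    x 0 ∈ Sq (Fin.last n) → x 0 ≠ x (Fin.last n) →
    p (x (Fin.last n)) (x 0) (Sq (Fin.last n)) = 0

/-- Status Quo Asymmetry. -/
def SQA (p : α → α → Finset α → ℝ) : Prop :=
  ∀ x y : α, x ≠ y → ∀ S T : Finset α, x ∈ S → y ∈ S → x ∈ T → y ∈ T →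
    p y x S = 0 → 0 < p x y T

/-- Nontrivial Reference Effect. -/
def NRE (p : α → α → Finset α → ℝ) : Prop :=
  ∀ x (S : Finset α), x ∈ S → 0 < p x x S

/-- Irrelevance of Dominated Alternatives. -/
def IDA (p : α → α → Finset α → ℝ) : Prop :=
  ∀ r (S : Finset α), S.Nonempty → r ∈ S → ∀ x ∈ S, ∀ y ∈ S, y ≠ r → y ≠ x →
    (∃ T : Finset α, x ∈ T ∧ y ∈ T ∧ 0 < p y x T) →
    p r x S = p r x (S.erase y)

/-- Ratio Independence of Dominant Alternatives. -/
def RIDA (p : α → α → Finset α → ℝ) : Prop :=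
  ∀ r (S : Finset α), S.Nonempty → r ∈ S → ∀ x ∈ S, x ≠ r →
    ∀ y ∈ S, y ≠ x → ∀ z ∈ S, z ≠ x →
      p x x S = 1 → 0 < p r y S * p r z S →
      p r y S / p r z S = p r y (S.erase x) / p r z (S.erase x)

/-- `Pset p r`: the set of alternatives that dominate `r`. -/
def Pset (p : α → α → Finset α → ℝ) (r : α) : Finset α :=
  univ.filter (fun s => s ≠ r ∧ ∃ T : Finset α, r ∈ T ∧ s ∈ T ∧ 0 < p r s T)

/-- Odds against the reference alternative. -/
def odds (p : α → α → Finset α → ℝ) (r : α) (S : Finset α) : ℝ :=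
  (1 - p r r S) / p r r S

/-- Decreasing Odds for the Reference Alternative. -/
def DORA (p : α → α → Finset α → ℝ) : Prop :=
  ∀ r (S : Finset α), S.Nonempty → r ∈ S → ∀ (n : ℕ) (U : Fin n → Finset α),
    (∀ i, U i ⊆ Pset p r ∧ (S ∩ U i).Nonempty) →
    0 < ∑ I ∈ (univ : Finset (Fin n)).powerset,
      (-1 : ℝ) ^ I.card * odds p r (S \ I.biUnion U)

/-- Decreasing Propensity of Choice for the Reference Alternative. -/
def DPCRA (p : α → α → Finset α → ℝ) : Prop :=
  ∀ r (S : Finset α), S.Nonempty → r ∈ S → ∀ (n : ℕ) (U : Fin n → Finset α),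
    (∀ i, U i ⊆ Pset p r ∧ (S ∩ U i).Nonempty) →
    0 < ∑ I ∈ (univ : Finset (Fin n)).powerset,
      (-1 : ℝ) ^ (n - I.card) * p r r (S \ I.biUnion U)

/-- Reference-independent CRA representation of a family of attention rules. -/
def RefIndepCRA (μ : α → Finset α → Finset α → ℝ) : Prop :=
  ∃ π : Finset α → ℝ, π ∅ = 0 ∧ (∀ D : Finset α, D.Nonempty → 0 < π D) ∧
    (∑ D ∈ (univ : Finset α).powerset, π D = 1) ∧
    ∀ r (S : Finset α), S.Nonempty → r ∈ S → ∀ D : Finset α, r ∈ D → D ⊆ S →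
      μ r D S = ∑ D' ∈ (univ : Finset α).powerset.filter (fun D' => D' ∩ S = D),
        (π D' + π (D'.erase r))

/-- The monotonicity property of Cattaneo et al. (2020). -/
def MonotonicAttention (r : α) (μ : Finset α → Finset α → ℝ) : Prop :=
  ∀ D S T : Finset α, r ∈ D → D ⊆ S → S ⊆ T → μ D T ≤ μ D S

/-- `(R, γ)` is an IRA representation of `p` (directly, in terms of attention maps). -/
def IsIRAPair (p : α → α → Finset α → ℝ) (R : α → α → Prop) (γ : α → α → ℝ) : Prop :=
  LinOrd R ∧ (∀ r, γ r r = 1 ∧ ∀ x, x ≠ r → 0 < γ r x ∧ γ r x < 1) ∧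
    ∀ r (S : Finset α), S.Nonempty → r ∈ S → ∀ x ∈ S,
      p r x S = ∑ D ∈ S.powerset.filter (fun D => r ∈ D ∧ IsMaxOf R x D),
        ((∏ a ∈ D, γ r a) * ∏ b ∈ S \ D, (1 - γ r b))

/-- Under NCC, choices cannot form a cycle of length two. -/
theorem NCC.pair_eq_zero {β : Type*} {p : β → β → Finset β → ℝ} (hncc : NCC p) {x y : β}
    {S T : Finset β}
    (hxy : x ≠ y) (hxS : x ∈ S) (hyS : y ∈ S) (hxT : x ∈ T) (hyT : y ∈ T)
    (h : 0 < p x y S) : p y x T = 0 := by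
  refine hncc 1 ![x, y] ![S, T] ?_ ?_ hxT hxy
  · intro i
    fin_cases i
    · exact ⟨⟨x, hxS⟩, hxS⟩
    · exact ⟨⟨x, hxT⟩, hyT⟩
  · intro i
    fin_cases i
    exact ⟨hyS, hxy.symm, h⟩

/-- Under NCC, choices cannot form a cycle of length three. -/
theorem NCC.triple_eq_zero {β : Type*} {p : β → β → Finset β → ℝ} (hncc : NCC p) {x y z : β}
    {S T U : Finset β} (hxy : x ≠ y) (hyz : y ≠ z) (hxz : x ≠ z)
    (hxS : x ∈ S) (hyS : y ∈ S) (hyT : y ∈ T) (hzT : z ∈ T) (hzU : z ∈ U) (hxU : x ∈ U)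
    (h₁ : 0 < p x y S) (h₂ : 0 < p y z T) : p z x U = 0 := by
  refine hncc 2 ![x, y, z] ![S, T, U] ?_ ?_ hxU hxz
  · intro i
    fin_cases i
    · exact ⟨⟨x, hxS⟩, hxS⟩
    · exact ⟨⟨y, hyT⟩, hyT⟩
    · exact ⟨⟨z, hzU⟩, hzU⟩
  · intro i
    fin_cases i
    · exact ⟨hyS, hxy.symm, h₁⟩
    · exact ⟨hzT, hyz.symm, h₂⟩

/-- under NCC and SQA, the revealed binary relation is a linear order. -/
theorem revealed_relation_linear_order (h2 : 2 ≤ Fintype.card α)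
    (p : α → α → Finset α → ℝ) (hp : IsRandomChoiceRule p)
    (hncc : NCC p) (hsqa : SQA p) :
    LinOrd (fun x y : α => x = y ∨ 0 < p y x ({x, y} : Finset α)) := by
  have pos_of_not_pos {x y : α} (hxy : x ≠ y) {S T : Finset α} (hxS : x ∈ S) (hyS : y ∈ S)
      (hxT : x ∈ T) (hyT : y ∈ T) (h : ¬ 0 < p y x S) : 0 < p x y T :=
    hsqa x y hxy S T hxS hyS hxT hyT (le_antisymm (not_lt.mp h) (hp.nonneg y x S))
  refine ⟨fun x y => ?_, fun x y => ?_, fun x y z => ?_⟩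
  · by_cases hxy : x = y
    · exact Or.inl (Or.inl hxy)
    · by_cases h : 0 < p y x {x, y}
      · exact Or.inl (Or.inr h)
      · exact Or.inr (Or.inr (pos_of_not_pos hxy (by simp) (by simp) (by simp) (by simp) h))
  · rintro (rfl | h₁) h₂
    · rfl
    · rcases h₂ with rfl | h₂
      · rfl
      · by_contra hxy
        exact h₂.ne' (hncc.pair_eq_zero (Ne.symm hxy) (by simp) (by simp) (by simp) (by simp) h₁)
  · rintro (rfl | h₁) h₂
    · exact h₂
    · rcases h₂ with rfl | h₂
      · exact Or.inr h₁
      · by_cases hxz : x = z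
        · exact Or.inl hxz
        by_cases hxy : x = y
        · subst hxy
          exact Or.inr h₂
        by_cases hyz : y = z
        · subst hyz
          exact Or.inr h₁
        refine Or.inr (by_contra fun h => ?_)
        have hzx : 0 < p x z {x, z} :=
          pos_of_not_pos hxz (by simp) (by simp) (by simp) (by simp) h
        exact hzx.ne' (hncc.triple_eq_zero (Ne.symm hyz) (Ne.symm hxy) (Ne.symm hxz)
          (by simp) (by simp) (by simp) (by simp) (by simp) (by simp) h₂ h₁)

end
end RDRAM
end

section
/- Suppose {p_r}_{r∈X} has an RD-RAM representation (⪰,{μ_r}) in which every μ_r satisfies the monotonicity property: μ_r(D,S) ≥ μ_r(D,T) whenever r ∈ D ⊆ S ⊆ T. Then {p_r}_{r∈X} satisfies weak regularity: for all distinct x,y ∈ X, if p_x(y,T) > 0 for some menu T containing x and y, then for every menu S with r ∈ S, x,y ∈ S, and y ∉ {r,x}, it holds that p_r(x,S) ≤ p_r(x,S∖{y}). -/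
open Finset
open scoped Classical

namespace RDRAM

noncomputable section

variable {α : Type*} [Fintype α] [DecidableEq α]

/-- An alternative chosen with positive probability at reference `x` is weakly preferred to `x`. -/
theorem IsRDRAMRep.rel_of_pos {p : α → α → Finset α → ℝ} {R : α → α → Prop}
    {μ : α → Finset α → Finset α → ℝ} (hrd : IsRDRAMRep p R μ) {x y : α} {T : Finset α}
    (hx : x ∈ T) (hy : y ∈ T) (hpos : 0 < p x y T) : R y x := by
  rw [hrd.2.2 x T ⟨x, hx⟩ hx y hy] at hpos
  obtain ⟨D, hD, -⟩ := Finset.exists_ne_zero_of_sum_ne_zero hpos.ne'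
  obtain ⟨-, hxD, hmax⟩ := Finset.mem_filter.1 hD
  exact hmax.2 x hxD

/-- monotonic attention rules imply weak regularity. -/
theorem monotone_implies_weak_regularity (h2 : 2 ≤ Fintype.card α)
    (p : α → α → Finset α → ℝ) (hp : IsRandomChoiceRule p)
    {R : α → α → Prop} {μ : α → Finset α → Finset α → ℝ}
    (hrd : IsRDRAMRep p R μ) (hmono : ∀ r, MonotonicAttention r (μ r)) :
    ∀ x y : α, x ≠ y → (∃ T : Finset α, x ∈ T ∧ y ∈ T ∧ 0 < p x y T) →
      ∀ r (S : Finset α), S.Nonempty → r ∈ S → x ∈ S → y ∈ S → y ≠ r → y ≠ x →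
        p r x S ≤ p r x (S.erase y) := by
  rintro x y hxy ⟨T, hxT, hyT, hpos⟩ r S hS hr hx hy hyr -
  have hR := hrd.rel_of_pos hxT hyT hpos
  have hr' : r ∈ S.erase y := Finset.mem_erase.2 ⟨hyr.symm, hr⟩
  rw [hrd.2.2 r S hS hr x hx,
    hrd.2.2 r (S.erase y) ⟨r, hr'⟩ hr' x (Finset.mem_erase.2 ⟨hxy, hx⟩)]
  have hsub : ∀ D ∈ S.powerset.filter (fun D => r ∈ D ∧ IsMaxOf R x D), D ⊆ S.erase y := by
    intro D hD
    obtain ⟨hDS, -, hmax⟩ := Finset.mem_filter.1 hD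
    exact Finset.subset_erase.2 ⟨Finset.mem_powerset.1 hDS,
      fun hyD => hxy (hrd.1.antisymm x y (hmax.2 y hyD) hR)⟩
  calc
    _ ≤ ∑ D ∈ S.powerset.filter (fun D => r ∈ D ∧ IsMaxOf R x D), μ r D (S.erase y) :=
      Finset.sum_le_sum fun D hD => hmono r D (S.erase y) S (Finset.mem_filter.1 hD).2.1
        (hsub D hD) (Finset.erase_subset y S)
    _ ≤ _ := Finset.sum_le_sum_of_subset_of_nonneg
      (fun D hD => Finset.mem_filter.2
        ⟨Finset.mem_powerset.2 (hsub D hD), (Finset.mem_filter.1 hD).2⟩)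
      fun D _ _ => (hrd.2.1 r).1.nonneg D (S.erase y)

end
end RDRAM
end
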